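/- arXiv:2207.04851 — 2 statements merged into one kernel-verified Lean document; each statement's English description precedes it below -/
import Mathlib

section
/- Let (ξ, θ, α) be a solution of (*) with (ξ, θ, α)(t) ∈ 𝒟. Then: (i) if ξ'(t) = 0, then the sign of ξ''(t) equals the sign of (g/4)·ln(m) − ξ(t); (ii) if θ'(t) = 0, then the sign of θ''(t) equals the sign of θ* − θ(t). -/
/-- The constant `m = m₁ + m₂ + 2/g`. -/
noncomputable def mconst (g m₁ m₂ : ℕ) : ℝ := (m₁ : ℝ) + (m₂ : ℝ) + 2 / (g : ℝ)

/-- The angle `θ* = arctan √(m₁/m₂)`. -/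
noncomputable def thetaStar (m₁ m₂ : ℕ) : ℝ :=
  Real.arctan (Real.sqrt ((m₁ : ℝ) / (m₂ : ℝ)))

/-- `l(θ) = m₁ cos² θ - m₂ sin² θ`. -/
noncomputable def lfun (m₁ m₂ : ℕ) (θ : ℝ) : ℝ :=
  (m₁ : ℝ) * Real.cos θ ^ 2 - (m₂ : ℝ) * Real.sin θ ^ 2

/-- `(ξ, θ, α)` is a (globally defined) solution of the ODE system (*):
`ξ' = cos α · sin 2θ`, `θ' = sin α · sin 2θ`,
`α' = sin α · sin 2θ · (exp((4/g)ξ) - m) + 2 cos α · l(θ)`. -/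
def IsSolution (g m₁ m₂ : ℕ) (ξ θ α : ℝ → ℝ) : Prop :=
  ∀ t : ℝ,
    HasDerivAt ξ (Real.cos (α t) * Real.sin (2 * θ t)) t ∧
    HasDerivAt θ (Real.sin (α t) * Real.sin (2 * θ t)) t ∧
    HasDerivAt α
      (Real.sin (α t) * Real.sin (2 * θ t) *
          (Real.exp (4 / (g : ℝ) * ξ t) - mconst g m₁ m₂) +
        2 * Real.cos (α t) * lfun m₁ m₂ (θ t)) t

theorem Real.sign_eq_sign_of_pos_iff_of_neg_iff {a b : ℝ} (hpos : 0 < a ↔ 0 < b)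
    (hneg : a < 0 ↔ b < 0) : Real.sign a = Real.sign b := by
  simp only [Real.sign, hpos, hneg]

theorem Real.sign_mul_of_pos_left {k : ℝ} (hk : 0 < k) (x : ℝ) :
    Real.sign (k * x) = Real.sign x :=
  Real.sign_eq_sign_of_pos_iff_of_neg_iff (mul_pos_iff_of_pos_left hk)
    (by rw [mul_neg_iff]; simp [hk, hk.not_gt])

theorem StrictMonoOn.sign_sub_eq {f : ℝ → ℝ} {s : Set ℝ} (hf : StrictMonoOn f s) {a b : ℝ}
    (ha : a ∈ s) (hb : b ∈ s) : Real.sign (f b - f a) = Real.sign (b - a) :=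
  Real.sign_eq_sign_of_pos_iff_of_neg_iff (by simp only [sub_pos, hf.lt_iff_lt ha hb])
    (by simp only [sub_neg, hf.lt_iff_lt hb ha])

theorem mconst_pos (g : ℕ) {m₁ : ℕ} (hm₁ : 0 < m₁) (m₂ : ℕ) : 0 < mconst g m₁ m₂ := by
  unfold mconst
  positivity

theorem sign_sub_exp_mul {k m : ℝ} (hk : 0 < k) (hm : 0 < m) (x : ℝ) :
    Real.sign (m - Real.exp (4 / k * x)) = Real.sign (k / 4 * Real.log m - x) := by
  have h := (Real.exp_strictMono.strictMonoOn Set.univ).sign_sub_eq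
    (Set.mem_univ (4 / k * x)) (Set.mem_univ (Real.log m))
  rw [Real.exp_log hm] at h
  rw [h, ← Real.sign_mul_of_pos_left (show 0 < k / 4 by positivity)]
  congr 1
  field_simp

theorem sign_lfun {m₁ m₂ : ℕ} (hm₂ : 0 < m₂) {θ : ℝ} (hθ : θ ∈ Set.Ioo 0 (Real.pi / 2)) :
    Real.sign (lfun m₁ m₂ θ) = Real.sign (thetaStar m₁ m₂ - θ) := by
  have hθ' : θ ∈ Set.Ioo (-(Real.pi / 2)) (Real.pi / 2) :=
    ⟨by linarith [Real.pi_pos, hθ.1], hθ.2⟩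
  have hcos : 0 < Real.cos θ := Real.cos_pos_of_mem_Ioo hθ'
  have htan : 0 < Real.tan θ := Real.tan_pos_of_pos_of_lt_pi_div_two hθ.1 hθ.2
  have hm : (0 : ℝ) < m₂ := by exact_mod_cast hm₂
  have hfactor : lfun m₁ m₂ θ = m₂ * Real.cos θ ^ 2 * (√(m₁ / m₂ : ℝ) + Real.tan θ) *
      (√(m₁ / m₂ : ℝ) - Real.tan θ) := by
    have hsq : √(m₁ / m₂ : ℝ) ^ 2 = m₁ / m₂ := Real.sq_sqrt (by positivity)
    have hm₁ : (m₁ : ℝ) = m₂ * √(m₁ / m₂ : ℝ) ^ 2 := by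
      rw [hsq]
      field_simp
    have hsin : Real.sin θ = Real.tan θ * Real.cos θ := (Real.tan_mul_cos hcos.ne').symm
    rw [lfun, hsin]
    linear_combination Real.cos θ ^ 2 * hm₁
  have h := Real.strictMonoOn_tan.sign_sub_eq hθ' (Real.arctan_mem_Ioo √(m₁ / m₂ : ℝ))
  rw [Real.tan_arctan] at h
  rw [hfactor, Real.sign_mul_of_pos_left (by positivity), h, thetaStar]

/-- Characterisation of extrema for solutions of (*) in `𝒟`:
(i) if `ξ'(t) = 0` then `sign ξ''(t) = sign ((g/4) ln m - ξ(t))`;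
(ii) if `θ'(t) = 0` then `sign θ''(t) = sign (θ* - θ(t))`. -/
theorem stmt6 (g m₁ m₂ : ℕ) (hg : g = 1 ∨ g = 2 ∨ g = 3 ∨ g = 4 ∨ g = 6)
    (hm₁ : 0 < m₁) (hm₂ : 0 < m₂)
    (ξ θ α : ℝ → ℝ) (hsol : IsSolution g m₁ m₂ ξ θ α)
    (hD : ∀ t : ℝ, θ t ∈ Set.Ioo 0 (Real.pi / 2)) (t : ℝ) :
    (∀ v : ℝ, Real.cos (α t) * Real.sin (2 * θ t) = 0 →
      HasDerivAt (fun s => Real.cos (α s) * Real.sin (2 * θ s)) v t →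
      Real.sign v =
        Real.sign ((g : ℝ) / 4 * Real.log (mconst g m₁ m₂) - ξ t)) ∧
    (∀ v : ℝ, Real.sin (α t) * Real.sin (2 * θ t) = 0 →
      HasDerivAt (fun s => Real.sin (α s) * Real.sin (2 * θ s)) v t →
      Real.sign v = Real.sign (thetaStar m₁ m₂ - θ t)) := by
  obtain ⟨-, hθ, hα⟩ := hsol t
  have hS : 0 < Real.sin (2 * θ t) :=
    Real.sin_pos_of_pos_of_lt_pi (by linarith [(hD t).1]) (by linarith [(hD t).2])
  have hsin := (hθ.const_mul 2).sin
  have hsq := Real.sin_sq_add_cos_sq (α t)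
  have hg0 : (0 : ℝ) < g := by
    have : 0 < g := by omega
    exact_mod_cast this
  refine ⟨fun v h0 hv => ?_, fun v h0 hv => ?_⟩
  · have hc : Real.cos (α t) = 0 := (mul_eq_zero.mp h0).resolve_right hS.ne'
    rw [← sign_sub_exp_mul hg0 (mconst_pos g hm₁ m₂),
      ← Real.sign_mul_of_pos_left (pow_pos hS 2) (_ - _), hv.unique (hα.cos.mul hsin)]
    congr 1
    rw [hc] at hsq ⊢
    linear_combination (-Real.sin (2 * θ t) ^ 2 *
      (Real.exp (4 / (g : ℝ) * ξ t) - mconst g m₁ m₂)) * hsq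
  · have hs : Real.sin (α t) = 0 := (mul_eq_zero.mp h0).resolve_right hS.ne'
    rw [← sign_lfun hm₂ (hD t), ← Real.sign_mul_of_pos_left (mul_pos two_pos hS) (lfun _ _ _),
      hv.unique (hα.sin.mul hsin)]
    congr 1
    rw [hs] at hsq ⊢
    linear_combination (2 * Real.sin (2 * θ t) * lfun m₁ m₂ (θ t)) * hsq
end

section
/- There exists R ∈ ℝ such that every ξ₀ > R is of type 1. In particular ξ₀* := inf{ r ∈ ℝ : every ξ₀ > r is of type 1 } is finite (ξ₀* < ∞). -/
/-- `Ξ Θ A` is the family of solutions of (*) indexed by the initial value `ξ₀`,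
with initial condition `(ξ, θ, α)(0) = (ξ₀, θ*, π/2)`. -/
def IsShootingFamily (g m₁ m₂ : ℕ) (Ξ Θ A : ℝ → ℝ → ℝ) : Prop :=
  ∀ ξ₀ : ℝ, IsSolution g m₁ m₂ (Ξ ξ₀) (Θ ξ₀) (A ξ₀) ∧
    Ξ ξ₀ 0 = ξ₀ ∧ Θ ξ₀ 0 = thetaStar m₁ m₂ ∧ A ξ₀ 0 = Real.pi / 2

/-- `ξ₀` is of type 1: there is `T > 0` with `θ_{ξ₀}(T) = θ*` and
`ξ'_{ξ₀}(t) ≠ 0` for all `t ∈ (0, T)`. -/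
def Type1 (m₁ m₂ : ℕ) (Ξ Θ A : ℝ → ℝ → ℝ) (ξ₀ : ℝ) : Prop :=
  ∃ T > (0 : ℝ), Θ ξ₀ T = thetaStar m₁ m₂ ∧
    ∀ t ∈ Set.Ioo (0 : ℝ) T, Real.cos (A ξ₀ t) * Real.sin (2 * Θ ξ₀ t) ≠ 0

open Real Set

/-- The weight `sin^m₁ θ · cos^m₂ θ`, which is maximal at `θ*`. -/
noncomputable def orbitWeight (m₁ m₂ : ℕ) (θ : ℝ) : ℝ := sin θ ^ m₁ * cos θ ^ m₂

/-- The quantity `-orbitWeight θ · cos α`, monotone along solutions as long as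
`exp ((4/g) ξ) ≥ m`. -/
noncomputable def energy (m₁ m₂ : ℕ) (θ α : ℝ → ℝ) (t : ℝ) : ℝ :=
  -(orbitWeight m₁ m₂ (θ t) * cos (α t))

/-- The factor `exp ((4/g) ξ) - m`. -/
noncomputable def damping (g m₁ m₂ : ℕ) (x : ℝ) : ℝ := exp (4 / (g : ℝ) * x) - mconst g m₁ m₂

theorem le_of_hasDerivAt_nonneg {f f' : ℝ → ℝ} {a b : ℝ} (hab : a ≤ b)
    (hf : ∀ x ∈ Icc a b, HasDerivAt f (f' x) x) (h0 : ∀ x ∈ Icc a b, 0 ≤ f' x) : f a ≤ f b := by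
  refine monotoneOn_of_deriv_nonneg (convex_Icc a b)
    (fun x hx => (hf x hx).continuousAt.continuousWithinAt)
    (fun x hx => (hf x (interior_subset hx)).differentiableAt.differentiableWithinAt)
    (fun x hx => ?_) (left_mem_Icc.2 hab) (right_mem_Icc.2 hab) hab
  rw [(hf x (interior_subset hx)).deriv]
  exact h0 x (interior_subset hx)

theorem mul_sub_le_of_le_hasDerivAt {f f' : ℝ → ℝ} {a b c : ℝ} (hab : a ≤ b)
    (hf : ∀ x ∈ Icc a b, HasDerivAt f (f' x) x) (h0 : ∀ x ∈ Icc a b, c ≤ f' x) :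
    c * (b - a) ≤ f b - f a := by
  have := le_of_hasDerivAt_nonneg (f := fun x => f x - c * x) (f' := fun x => f' x - c * 1) hab
    (fun x hx => (hf x hx).sub ((hasDerivAt_id x).const_mul c))
    (fun x hx => by linarith [h0 x hx])
  linarith

theorem exists_gt_of_hasDerivAt_pos {f : ℝ → ℝ} {f' a b : ℝ} (hab : a < b)
    (hf : HasDerivAt f f' a) (h0 : 0 < f') : ∃ x ∈ Ioo a b, f a < f x := by
  have h := (hasDerivAt_iff_tendsto_slope.1 hf).mono_left
    (nhdsWithin_mono a (fun x (hx : x ∈ Ioi a) => ne_of_gt hx))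
  obtain ⟨x, hx, hx'⟩ := ((h.eventually (lt_mem_nhds h0)).and (Ioo_mem_nhdsGT hab)).exists
  refine ⟨x, hx', ?_⟩
  rw [slope_def_field, div_pos_iff_of_pos_right (sub_pos.2 hx'.1)] at hx
  linarith

theorem lt_of_forall_ne_of_continuous {f : ℝ → ℝ} {a b c : ℝ} (hf : Continuous f) (hab : a ≤ b)
    (ha : c < f a) (hne : ∀ x ∈ Icc a b, f x ≠ c) : c < f b := by
  by_contra! h
  obtain ⟨x, hx, hxc⟩ := intermediate_value_Icc' hab hf.continuousOn ⟨h, ha.le⟩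
  exact hne x hx hxc

/-- A function with `r' ≥ q (1 + r²)` cannot exist on an interval of length `π / q`. -/
theorem riccati_not_on_long_interval {r r' : ℝ → ℝ} {a b q : ℝ} (hab : a ≤ b)
    (hr : ∀ x ∈ Icc a b, HasDerivAt r (r' x) x)
    (hq : ∀ x ∈ Icc a b, q * (1 + r x ^ 2) ≤ r' x) : q * (b - a) < π := by
  have h := mul_sub_le_of_le_hasDerivAt hab (c := q) (fun x hx => (hr x hx).arctan)
    (fun x hx => by
      have h1 : 0 < 1 + r x ^ 2 := by positivity
      rw [one_div, inv_mul_eq_div, le_div_iff₀ h1]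
      exact hq x hx)
  linarith [arctan_lt_pi_div_two (r b), neg_pi_div_two_lt_arctan (r a)]

section ThetaStar

variable {m₁ m₂ : ℕ}

theorem thetaStar_mem (hm₁ : 0 < m₁) (hm₂ : 0 < m₂) : thetaStar m₁ m₂ ∈ Ioo 0 (π / 2) := by
  refine ⟨?_, arctan_lt_pi_div_two _⟩
  rw [thetaStar, arctan_pos]
  positivity

theorem cos_sq_thetaStar (hm₂ : 0 < m₂) :
    cos (thetaStar m₁ m₂) ^ 2 = m₂ / (m₁ + m₂ : ℝ) := by
  have h₂ : (0 : ℝ) < m₂ := by exact_mod_cast hm₂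
  rw [thetaStar, cos_sq_arctan, sq_sqrt (by positivity)]
  field_simp
  ring

theorem sin_sq_thetaStar (hm₂ : 0 < m₂) :
    sin (thetaStar m₁ m₂) ^ 2 = m₁ / (m₁ + m₂ : ℝ) := by
  have h₂ : (0 : ℝ) < m₂ := by exact_mod_cast hm₂
  rw [sin_sq, cos_sq_thetaStar hm₂]
  field_simp
  ring

theorem lfun_neg_of_thetaStar_lt (hm₁ : 0 < m₁) (hm₂ : 0 < m₂) {θ : ℝ}
    (h : thetaStar m₁ m₂ < θ) (hθ : θ ∈ Ioo 0 (π / 2)) : lfun m₁ m₂ θ < 0 := by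
  have h₁ : (0 : ℝ) < m₁ := by exact_mod_cast hm₁
  have h₂ : (0 : ℝ) < m₂ := by exact_mod_cast hm₂
  obtain ⟨hs, hs'⟩ := thetaStar_mem hm₁ hm₂
  have hlt : sin (thetaStar m₁ m₂) < sin θ :=
    sin_lt_sin_of_lt_of_le_pi_div_two (by linarith [pi_pos]) hθ.2.le h
  have h0 : 0 < sin (thetaStar m₁ m₂) := sin_pos_of_pos_of_lt_pi hs (by linarith [pi_pos])
  have hsq : sin (thetaStar m₁ m₂) ^ 2 < sin θ ^ 2 := by gcongr
  rw [sin_sq_thetaStar hm₂, div_lt_iff₀ (by positivity)] at hsq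
  rw [lfun, cos_sq']
  linarith

theorem pow_le_pow_mul_exp {x x₀ : ℝ} (hx : 0 ≤ x) (hx₀ : 0 < x₀) (k : ℕ) :
    x ^ k ≤ x₀ ^ k * exp (k * (x / x₀ - 1)) := by
  rw [exp_nat_mul, ← mul_pow]
  gcongr
  have := add_one_le_exp (x / x₀ - 1)
  rw [← div_le_iff₀' hx₀]
  linarith

theorem orbitWeight_le (hm₁ : 0 < m₁) (hm₂ : 0 < m₂) (θ : ℝ) :
    orbitWeight m₁ m₂ θ ≤ orbitWeight m₁ m₂ (thetaStar m₁ m₂) := by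
  have h₁ : (0 : ℝ) < m₁ := by exact_mod_cast hm₁
  have h₂ : (0 : ℝ) < m₂ := by exact_mod_cast hm₂
  obtain ⟨hs, hs'⟩ := thetaStar_mem hm₁ hm₂
  have hs0 : 0 < sin (thetaStar m₁ m₂) := sin_pos_of_pos_of_lt_pi hs (by linarith [pi_pos])
  have hc0 : 0 < cos (thetaStar m₁ m₂) := cos_pos_of_mem_Ioo ⟨by linarith [pi_pos], hs'⟩
  refine le_of_sq_le_sq ?_ (by unfold orbitWeight; positivity)
  have e1 : ∀ x, orbitWeight m₁ m₂ x ^ 2 = (sin x ^ 2) ^ m₁ * (cos x ^ 2) ^ m₂ := fun x => by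
    rw [orbitWeight]; ring
  have hS := pow_le_pow_mul_exp (sq_nonneg (sin θ)) (pow_pos hs0 2) m₁
  have hC := pow_le_pow_mul_exp (sq_nonneg (cos θ)) (pow_pos hc0 2) m₂
  have hexp : exp (m₁ * (sin θ ^ 2 / sin (thetaStar m₁ m₂) ^ 2 - 1)) *
      exp (m₂ * (cos θ ^ 2 / cos (thetaStar m₁ m₂) ^ 2 - 1)) = 1 := by
    rw [← exp_add, exp_eq_one_iff, sin_sq_thetaStar hm₂, cos_sq_thetaStar hm₂, cos_sq']
    field_simp
    ring
  rw [e1, e1]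
  calc _ ≤ _ := mul_le_mul hS hC (by positivity) (by positivity)
    _ = (sin (thetaStar m₁ m₂) ^ 2) ^ m₁ * (cos (thetaStar m₁ m₂) ^ 2) ^ m₂ *
        (exp (m₁ * (sin θ ^ 2 / sin (thetaStar m₁ m₂) ^ 2 - 1)) *
          exp (m₂ * (cos θ ^ 2 / cos (thetaStar m₁ m₂) ^ 2 - 1))) := by ring
    _ = _ := by rw [hexp, mul_one]

theorem orbitWeight_pos {θ : ℝ} (hθ : θ ∈ Ioo 0 (π / 2)) : 0 < orbitWeight m₁ m₂ θ := by
  have hs : 0 < sin θ := sin_pos_of_pos_of_lt_pi hθ.1 (by linarith [hθ.2, pi_pos])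
  have hc : 0 < cos θ := cos_pos_of_mem_Ioo ⟨by linarith [hθ.1, pi_pos], hθ.2⟩
  unfold orbitWeight
  positivity

theorem two_mul_orbitWeight_le_sin (hm₁ : 0 < m₁) (hm₂ : 0 < m₂) {θ : ℝ}
    (hθ : θ ∈ Ioo 0 (π / 2)) : 2 * orbitWeight m₁ m₂ θ ≤ sin (2 * θ) := by
  have hs : 0 < sin θ := sin_pos_of_pos_of_lt_pi hθ.1 (by linarith [hθ.2, pi_pos])
  have hc : 0 < cos θ := cos_pos_of_mem_Ioo ⟨by linarith [hθ.1, pi_pos], hθ.2⟩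
  have h1 := pow_le_of_le_one hs.le (sin_le_one θ) hm₁.ne'
  have h2 := pow_le_of_le_one hc.le (cos_le_one θ) hm₂.ne'
  have := mul_le_mul h1 h2 (by positivity) hs.le
  rw [sin_two_mul, orbitWeight]
  linarith

theorem sin_two_mul_pos {θ : ℝ} (hθ : θ ∈ Ioo 0 (π / 2)) : 0 < sin (2 * θ) :=
  sin_pos_of_pos_of_lt_pi (by linarith [hθ.1]) (by linarith [hθ.2])

end ThetaStar

namespace IsSolution

variable {g m₁ m₂ : ℕ} {ξ θ α : ℝ → ℝ}

theorem continuous_xi (h : IsSolution g m₁ m₂ ξ θ α) : Continuous ξ :=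
  continuous_iff_continuousAt.2 fun t => (h t).1.continuousAt

theorem continuous_theta (h : IsSolution g m₁ m₂ ξ θ α) : Continuous θ :=
  continuous_iff_continuousAt.2 fun t => (h t).2.1.continuousAt

theorem theta_mem (h : IsSolution g m₁ m₂ ξ θ α) (h0 : θ 0 ∈ Ioo 0 (π / 2)) {t : ℝ}
    (ht : 0 ≤ t) : θ t ∈ Ioo 0 (π / 2) := by
  have hne : ∀ t, 0 ≤ t → sin (2 * θ t) ≠ 0 := by
    intro t ht hz
    have hd : ∀ x ∈ Icc 0 t, HasDerivAt (fun x => sin (2 * θ x) ^ 2 * exp (4 * x))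
        (4 * sin (2 * θ x) ^ 2 * exp (4 * x) * (1 + cos (2 * θ x) * sin (α x))) x := by
      intro x _
      have := ((((h x).2.1.const_mul 2).sin).pow 2).mul (((hasDerivAt_id x).const_mul 4).exp)
      refine this.congr_deriv ?_
      simp only [id, Pi.pow_apply]
      push_cast
      ring
    have hm := le_of_hasDerivAt_nonneg ht hd fun x _ => by
      have : |cos (2 * θ x) * sin (α x)| ≤ 1 := by
        rw [abs_mul]
        exact mul_le_one₀ (abs_cos_le_one _) (abs_nonneg _) (abs_sin_le_one _)
      have := (abs_le.1 this).1
      have : 0 ≤ 1 + cos (2 * θ x) * sin (α x) := by linarith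
      positivity
    simp only [hz] at hm
    have := sin_two_mul_pos h0
    have : 0 < sin (2 * θ 0) ^ 2 * exp (4 * 0) := by positivity
    linarith
  refine ⟨lt_of_forall_ne_of_continuous h.continuous_theta ht h0.1 fun x hx hz =>
    hne x hx.1 (by rw [hz]; simp), ?_⟩
  have := lt_of_forall_ne_of_continuous (f := fun t => -θ t) (c := -(π / 2))
    h.continuous_theta.neg ht (neg_lt_neg h0.2) fun x hx hz =>
      hne x hx.1 (by rw [neg_inj.1 hz, mul_div_cancel₀ _ two_ne_zero, sin_pi])
  linarith

theorem hasDerivAt_energy (h : IsSolution g m₁ m₂ ξ θ α) (hm₁ : 0 < m₁) (hm₂ : 0 < m₂) (t : ℝ) :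
    HasDerivAt (energy m₁ m₂ θ α)
      (orbitWeight m₁ m₂ (θ t) * sin (2 * θ t) * sin (α t) ^ 2 * damping g m₁ m₂ (ξ t)) t := by
  obtain ⟨j, rfl⟩ := Nat.exists_eq_add_of_lt hm₁
  obtain ⟨k, rfl⟩ := Nat.exists_eq_add_of_lt hm₂
  obtain ⟨-, hθ, hα⟩ := h t
  refine (((hθ.sin.pow _).mul (hθ.cos.pow _)).mul hα.cos).neg.congr_deriv ?_
  rw [damping, orbitWeight, lfun, sin_two_mul]
  simp only [Nat.add_sub_cancel, Nat.zero_add, Pi.mul_apply, Pi.pow_apply]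
  push_cast
  ring

theorem hasDerivAt_sin_div_lfun (h : IsSolution g m₁ m₂ ξ θ α) {t : ℝ}
    (hl : lfun m₁ m₂ (θ t) ≠ 0) :
    HasDerivAt (fun t => sin (α t) / lfun m₁ m₂ (θ t))
      (2 * cos (α t) ^ 2
        + cos (α t) * sin (2 * θ t) * damping g m₁ m₂ (ξ t) * (sin (α t) / lfun m₁ m₂ (θ t))
        + (m₁ + m₂) * (sin (2 * θ t) * (sin (α t) / lfun m₁ m₂ (θ t))) ^ 2) t := by
  obtain ⟨-, hθ, hα⟩ := h t
  have hl' : HasDerivAt (fun t => lfun m₁ m₂ (θ t))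
      (-((m₁ + m₂) * sin (2 * θ t) ^ 2 * sin (α t))) t := by
    refine (((hθ.cos.pow 2).const_mul _).sub ((hθ.sin.pow 2).const_mul _)).congr_deriv ?_
    rw [sin_two_mul]
    push_cast
    ring
  refine (hα.sin.div hl' hl).congr_deriv ?_
  rw [damping]
  field_simp
  ring

theorem sub_le_xi (h : IsSolution g m₁ m₂ ξ θ α) {t : ℝ} (ht : 0 ≤ t) : ξ 0 - t ≤ ξ t := by
  have := mul_sub_le_of_le_hasDerivAt ht (c := -1) (fun x _ => (h x).1) fun x _ => by
    have : |cos (α x) * sin (2 * θ x)| ≤ 1 := by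
      rw [abs_mul]
      exact mul_le_one₀ (abs_cos_le_one _) (abs_nonneg _) (abs_sin_le_one _)
    exact (abs_le.1 this).1
  linarith

theorem abs_theta_sub_le (h : IsSolution g m₁ m₂ ξ θ α) {t : ℝ} (ht : 0 ≤ t) :
    |θ t - θ 0| ≤ t := by
  have hb : ∀ x, |sin (α x) * sin (2 * θ x)| ≤ 1 := fun x => by
    rw [abs_mul]
    exact mul_le_one₀ (abs_sin_le_one _) (abs_nonneg _) (abs_sin_le_one _)
  have h1 := mul_sub_le_of_le_hasDerivAt ht (c := -1) (fun x _ => (h x).2.1) fun x _ =>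
    (abs_le.1 (hb x)).1
  have h2 := mul_sub_le_of_le_hasDerivAt ht (c := -1) (fun x _ => (h x).2.1.neg) fun x _ =>
    neg_le_neg (abs_le.1 (hb x)).2
  simp only [Pi.neg_apply] at h2
  rw [abs_le]
  constructor <;> linarith

theorem energy_mono (h : IsSolution g m₁ m₂ ξ θ α) (hm₁ : 0 < m₁) (hm₂ : 0 < m₂)
    (h0 : θ 0 ∈ Ioo 0 (π / 2)) {a b : ℝ} (ha : 0 ≤ a) (hab : a ≤ b)
    (hK : ∀ t ∈ Icc a b, 0 ≤ damping g m₁ m₂ (ξ t)) :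
    energy m₁ m₂ θ α a ≤ energy m₁ m₂ θ α b :=
  le_of_hasDerivAt_nonneg hab (fun x _ => h.hasDerivAt_energy hm₁ hm₂ x) fun x hx => by
    have hx0 := h.theta_mem h0 (ha.trans hx.1)
    have := orbitWeight_pos (m₁ := m₁) (m₂ := m₂) hx0
    have := sin_two_mul_pos hx0
    have := hK x hx
    positivity

theorem energy_pos (h : IsSolution g m₁ m₂ ξ θ α) (hm₁ : 0 < m₁) (hm₂ : 0 < m₂)
    (h0 : θ 0 ∈ Ioo 0 (π / 2)) (hα0 : α 0 = π / 2) {t : ℝ} (ht : 0 < t)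
    (hK : ∀ s ∈ Icc 0 t, 0 < damping g m₁ m₂ (ξ s)) : 0 < energy m₁ m₂ θ α t := by
  have hpos := hK 0 ⟨le_rfl, ht.le⟩
  have hw := orbitWeight_pos (m₁ := m₁) (m₂ := m₂) h0
  have hs := sin_two_mul_pos h0
  obtain ⟨x, hx, hx'⟩ := exists_gt_of_hasDerivAt_pos ht (h.hasDerivAt_energy hm₁ hm₂ 0)
    (by rw [hα0, sin_pi_div_two]; positivity)
  have he0 : energy m₁ m₂ θ α 0 = 0 := by rw [energy, hα0]; simp
  rw [he0] at hx'
  exact hx'.trans_le (h.energy_mono hm₁ hm₂ h0 hx.1.le hx.2.le fun s hs =>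
    (hK s ⟨hx.1.le.trans hs.1, hs.2⟩).le)

/-- The gap between the energy and its maximal possible value grows at most exponentially. -/
theorem energy_gap_le (h : IsSolution g m₁ m₂ ξ θ α) (hm₁ : 0 < m₁) (hm₂ : 0 < m₂)
    (h0 : θ 0 ∈ Ioo 0 (π / 2)) {a b : ℝ} (ha : 0 ≤ a) (hab : a ≤ b) :
    orbitWeight m₁ m₂ (thetaStar m₁ m₂) - energy m₁ m₂ θ α b ≤
      (orbitWeight m₁ m₂ (thetaStar m₁ m₂) - energy m₁ m₂ θ α a) *
        exp (2 * mconst g m₁ m₂ * (b - a)) := by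
  set p := orbitWeight m₁ m₂ (thetaStar m₁ m₂)
  set M := mconst g m₁ m₂ with hM
  have hM0 : 0 ≤ M := by rw [hM, mconst]; positivity
  have hd : ∀ x ∈ Icc a b, HasDerivAt
      (fun x => (energy m₁ m₂ θ α x - p) * exp (2 * M * (a - x)))
      ((orbitWeight m₁ m₂ (θ x) * sin (2 * θ x) * sin (α x) ^ 2 * damping g m₁ m₂ (ξ x)
        + 2 * M * (p - energy m₁ m₂ θ α x)) * exp (2 * M * (a - x))) x := fun x _ => by
    refine (((h.hasDerivAt_energy hm₁ hm₂ x).sub_const p).mul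
      ((((hasDerivAt_id x).const_sub a).const_mul (2 * M)).exp)).congr_deriv ?_
    simp only [id]
    ring
  have hmono := le_of_hasDerivAt_nonneg hab hd fun x hx => by
    refine mul_nonneg ?_ (exp_pos _).le
    have hx0 := h.theta_mem h0 (ha.trans hx.1)
    have hw := orbitWeight_pos (m₁ := m₁) (m₂ := m₂) hx0
    have hwp : orbitWeight m₁ m₂ (θ x) ≤ p := orbitWeight_le hm₁ hm₂ (θ x)
    have hs := sin_two_mul_pos hx0
    have hs1 := sin_le_one (2 * θ x)
    have hK : -M ≤ damping g m₁ m₂ (ξ x) := by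
      rw [damping, ← hM]; linarith [exp_pos (4 / (g : ℝ) * ξ x)]
    have hA : orbitWeight m₁ m₂ (θ x) * sin (α x) ^ 2 ≤ 2 * (p - energy m₁ m₂ θ α x) := by
      rw [energy, sin_sq]
      nlinarith [sq_nonneg (1 + cos (α x))]
    have hB : 0 ≤ orbitWeight m₁ m₂ (θ x) * sin (α x) ^ 2 := by positivity
    have hC : orbitWeight m₁ m₂ (θ x) * sin (α x) ^ 2 * sin (2 * θ x) ≤
        2 * (p - energy m₁ m₂ θ α x) := (mul_le_of_le_one_right hB hs1).trans hA
    have hD : 0 ≤ orbitWeight m₁ m₂ (θ x) * sin (α x) ^ 2 * sin (2 * θ x) := by positivity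
    nlinarith [mul_le_mul_of_nonneg_left hK hD, mul_le_mul_of_nonneg_left hC hM0]
  simp only [sub_self, mul_zero, exp_zero, mul_one] at hmono
  have hE : exp (2 * M * (a - b)) * exp (2 * M * (b - a)) = 1 := by
    rw [← exp_add]; ring_nf; simp
  have := mul_le_mul_of_nonneg_right hmono (exp_pos (2 * M * (b - a))).le
  rw [mul_assoc (energy m₁ m₂ θ α b - p), hE] at this
  linarith

/-- Bounds on `cos α` and `sin 2θ` when the energy is at least half its maximal value. -/
theorem bounds_of_energy (hm₁ : 0 < m₁) (hm₂ : 0 < m₂) {t : ℝ} (ht : θ t ∈ Ioo 0 (π / 2))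
    (hE : orbitWeight m₁ m₂ (thetaStar m₁ m₂) / 2 ≤ energy m₁ m₂ θ α t) :
    cos (α t) ≤ -(1 / 2) ∧ orbitWeight m₁ m₂ (thetaStar m₁ m₂) ≤ sin (2 * θ t) := by
  have hw := orbitWeight_pos (m₁ := m₁) (m₂ := m₂) ht
  have hp := orbitWeight_pos (m₁ := m₁) (m₂ := m₂) (thetaStar_mem hm₁ hm₂)
  have hwp := orbitWeight_le hm₁ hm₂ (θ t)
  have hS := two_mul_orbitWeight_le_sin hm₁ hm₂ ht
  rw [energy] at hE
  constructor
  · by_contra! hc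
    nlinarith
  · nlinarith [neg_one_le_cos (α t)]

/-- For large initial height the energy quickly gets close to its maximal possible value. -/
theorem exists_energy_ge (hg : 0 < g) (hm₁ : 0 < m₁) (hm₂ : 0 < m₂) {ε : ℝ} (hε : 0 < ε)
    (hεp : ε ≤ orbitWeight m₁ m₂ (thetaStar m₁ m₂)) :
    ∃ R : ℝ, ∀ ξ θ α : ℝ → ℝ, IsSolution g m₁ m₂ ξ θ α → R < ξ 0 →
      θ 0 = thetaStar m₁ m₂ → α 0 = π / 2 →
      ∃ s ∈ Ioc (0 : ℝ) 1,
        orbitWeight m₁ m₂ (thetaStar m₁ m₂) - ε ≤ energy m₁ m₂ θ α s := by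
  have hmem := thetaStar_mem hm₁ hm₂
  set p := orbitWeight m₁ m₂ (thetaStar m₁ m₂) with hp
  have hp0 : 0 < p := orbitWeight_pos hmem
  have hp1 : 2 * p ≤ 1 := (two_mul_orbitWeight_le_sin hm₁ hm₂ hmem).trans (sin_le_one _)
  have hcont : Continuous (orbitWeight m₁ m₂) := by unfold orbitWeight; fun_prop
  obtain ⟨δ, hδ, hδ'⟩ := Metric.continuousAt_iff.1
    (hcont.continuousAt (x := thetaStar m₁ m₂)) (ε / 2) (half_pos hε)
  obtain ⟨τ, hτ0, hτ⟩ := exists_between (lt_min hδ one_pos)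
  have hτδ := hτ.trans_le (min_le_left _ _)
  have hτ1 := hτ.trans_le (min_le_right _ _)
  set K := 4 / (p * ε * τ) with hKdef
  have hK0 : 0 < K := by positivity
  have hκ : 0 < 4 / (g : ℝ) := by positivity
  have htend := tendsto_exp_atTop.comp (Filter.tendsto_id.const_mul_atTop hκ)
  obtain ⟨R, hR⟩ := Filter.eventually_atTop.1
    (htend.eventually (Filter.eventually_ge_atTop (K + mconst g m₁ m₂)))
  refine ⟨R + 1, fun ξ θ α h hξ hθ0 hα0 => ?_⟩
  have h0 : θ 0 ∈ Ioo 0 (π / 2) := by rw [hθ0]; exact hmem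
  have hdamp : ∀ t ∈ Icc 0 τ, K ≤ damping g m₁ m₂ (ξ t) := fun t ht => by
    have := hR (ξ t) (by linarith [h.sub_le_xi ht.1, ht.2])
    simp only [Function.comp_apply, id] at this
    rw [damping]
    linarith
  have hweight : ∀ t ∈ Icc 0 τ, p - ε / 2 ≤ orbitWeight m₁ m₂ (θ t) := fun t ht => by
    have hd := hδ' (x := θ t) (by
      rw [dist_eq, ← hθ0]
      linarith [h.abs_theta_sub_le ht.1, ht.2])
    rw [dist_eq, ← hp] at hd
    linarith [(abs_lt.1 hd).1]
  by_contra! hcon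
  have hsin : ∀ t ∈ Ioc 0 τ, ε / 2 ≤ sin (α t) ^ 2 := fun t ht => by
    by_contra! hlt
    have hE := hcon t ⟨ht.1, by linarith [ht.2]⟩
    have hEpos := h.energy_pos hm₁ hm₂ h0 hα0 ht.1 fun s hs =>
      hK0.trans_le (hdamp s ⟨hs.1, hs.2.trans ht.2⟩)
    have hw := hweight t ⟨ht.1.le, ht.2⟩
    have hwpos := orbitWeight_pos (m₁ := m₁) (m₂ := m₂) (h.theta_mem h0 ht.1.le)
    rw [energy] at hE hEpos
    have hc : cos (α t) < 0 := by
      by_contra! hc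
      nlinarith
    rw [sin_sq] at hlt
    have hc1 : 1 - ε / 2 < -cos (α t) := by nlinarith [neg_one_le_cos (α t)]
    nlinarith
  have hsin' : ∀ t ∈ Icc 0 τ, ε / 2 ≤ sin (α t) ^ 2 := fun t ht => by
    rcases ht.1.eq_or_lt with rfl | hlt
    · rw [hα0, sin_pi_div_two]; linarith
    · exact hsin t ⟨hlt, ht.2⟩
  have hgrow := mul_sub_le_of_le_hasDerivAt hτ0.le (c := p / 2 * p * (ε / 2) * K)
    (fun x _ => h.hasDerivAt_energy hm₁ hm₂ x) fun x hx => by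
      have hx0 := h.theta_mem h0 hx.1
      have hw := hweight x hx
      have hS := two_mul_orbitWeight_le_sin hm₁ hm₂ hx0
      have h1 : p / 2 ≤ orbitWeight m₁ m₂ (θ x) := by linarith
      have h2 : p ≤ sin (2 * θ x) := by linarith
      have h3 := hsin' x hx
      have h4 := hdamp x hx
      have := sin_two_mul_pos hx0
      have := orbitWeight_pos (m₁ := m₁) (m₂ := m₂) hx0
      gcongr
  have he0 : energy m₁ m₂ θ α 0 = 0 := by rw [energy, hα0]; simp
  have hval : p / 2 * p * (ε / 2) * K * (τ - 0) = p := by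
    rw [hKdef]; field_simp; ring
  rw [hval, he0] at hgrow
  have := hcon τ ⟨hτ0, hτ1.le⟩
  linarith

/-- If the energy stays at least half maximal, the solution descends to any given height. -/
theorem exists_first_time (h : IsSolution g m₁ m₂ ξ θ α) (hm₁ : 0 < m₁) (hm₂ : 0 < m₂)
    (h0 : θ 0 ∈ Ioo 0 (π / 2)) {s c : ℝ} (hs : 0 ≤ s)
    (hE : ∀ t, s ≤ t → (∀ u ∈ Icc 0 t, c ≤ ξ u) →
      orbitWeight m₁ m₂ (thetaStar m₁ m₂) / 2 ≤ energy m₁ m₂ θ α t) (hc : c < ξ 0) :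
    ∃ t, 0 ≤ t ∧ ξ t = c ∧ ∀ u ∈ Icc 0 t, c ≤ ξ u := by
  set p := orbitWeight m₁ m₂ (thetaStar m₁ m₂)
  have hp0 : 0 < p := orbitWeight_pos (thetaStar_mem hm₁ hm₂)
  have hne : ∃ t, 0 ≤ t ∧ ξ t ≤ c := by
    by_contra! hcon
    set t := s + (ξ s - c) / (p / 2) with ht
    have hst : s ≤ t := by
      have : 0 ≤ (ξ s - c) / (p / 2) := div_nonneg (by linarith [hcon s hs]) (by positivity)
      linarith
    have := mul_sub_le_of_le_hasDerivAt hst (c := p / 2) (fun x _ => (h x).1.neg) fun x hx => by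
      obtain ⟨h1, h2⟩ := bounds_of_energy hm₁ hm₂ (h.theta_mem h0 (hs.trans hx.1))
        (hE x hx.1 fun u hu => (hcon u hu.1).le)
      change p ≤ _ at h2
      nlinarith
    have e : p / 2 * (t - s) = ξ s - c := by rw [ht]; field_simp; ring
    simp only [Pi.neg_apply] at this
    linarith [hcon t (hs.trans hst)]
  have hclosed : IsClosed {t | 0 ≤ t ∧ ξ t ≤ c} :=
    (isClosed_le continuous_const continuous_id).inter
      (isClosed_le h.continuous_xi continuous_const)
  have hbdd : BddBelow {t | 0 ≤ t ∧ ξ t ≤ c} := ⟨0, fun t ht => ht.1⟩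
  obtain ⟨ht0, htc⟩ := hclosed.csInf_mem hne hbdd
  set t := sInf {t | 0 ≤ t ∧ ξ t ≤ c}
  have hbefore : ∀ u, 0 ≤ u → u < t → c < ξ u := fun u hu hut => by
    by_contra! hle
    exact hut.not_ge (csInf_le hbdd ⟨hu, hle⟩)
  have hge : c ≤ ξ t := by
    by_contra! hlt
    obtain ⟨x, hx, hxc⟩ := intermediate_value_Ioo' ht0 h.continuous_xi.continuousOn ⟨hlt, hc⟩
    exact (hbefore x hx.1.le hx.2).ne' hxc
  refine ⟨t, ht0, htc.antisymm hge, fun u hu => ?_⟩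
  rcases hu.2.eq_or_lt with rfl | hlt
  · exact hge
  · exact (hbefore u hu.1 hlt).le

/-- If the energy is at least half maximal during a long time before and after the damping has
dropped to `1`, then `θ` cannot stay above `θ*`. -/
theorem not_thetaStar_lt (h : IsSolution g m₁ m₂ ξ θ α) (hm₁ : 0 < m₁) (hm₂ : 0 < m₂)
    (h0 : θ 0 ∈ Ioo 0 (π / 2)) {a b c : ℝ} (ha : 0 ≤ a) (hab : a ≤ b) (hbc : b ≤ c)
    (hlen₁ : π ≤ orbitWeight m₁ m₂ (thetaStar m₁ m₂) ^ 2 * (b - a))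
    (hlen₂ : π ≤ orbitWeight m₁ m₂ (thetaStar m₁ m₂) ^ 2 * (c - b))
    (hE : ∀ t ∈ Icc a c, orbitWeight m₁ m₂ (thetaStar m₁ m₂) / 2 ≤ energy m₁ m₂ θ α t)
    (hK₁ : ∀ t ∈ Icc a b, 0 ≤ damping g m₁ m₂ (ξ t))
    (hK₂ : ∀ t ∈ Icc b c, damping g m₁ m₂ (ξ t) ≤ 1)
    (hθ : ∀ t ∈ Icc a c, thetaStar m₁ m₂ < θ t) : False := by
  have hmem := thetaStar_mem hm₁ hm₂
  set p := orbitWeight m₁ m₂ (thetaStar m₁ m₂)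
  have hp0 : 0 < p := orbitWeight_pos hmem
  have hp1 : 2 * p ≤ 1 := (two_mul_orbitWeight_le_sin hm₁ hm₂ hmem).trans (sin_le_one _)
  set r : ℝ → ℝ := fun t => sin (α t) / lfun m₁ m₂ (θ t)
  set r' : ℝ → ℝ := fun t => 2 * cos (α t) ^ 2
    + cos (α t) * sin (2 * θ t) * damping g m₁ m₂ (ξ t) * r t
    + (m₁ + m₂) * (sin (2 * θ t) * r t) ^ 2 with hr'
  have hr : ∀ t ∈ Icc a c, HasDerivAt r (r' t) t := fun t ht =>
    h.hasDerivAt_sin_div_lfun (lfun_neg_of_thetaStar_lt hm₁ hm₂ (hθ t ht)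
      (h.theta_mem h0 (ha.trans ht.1))).ne
  have hn : (2 : ℝ) ≤ m₁ + m₂ := by exact_mod_cast (by omega : 2 ≤ m₁ + m₂)
  have hgrowth : ∀ t ∈ Icc a c,
      (r t ≤ 0 ∧ 0 ≤ damping g m₁ m₂ (ξ t) ∨ 0 ≤ r t ∧ damping g m₁ m₂ (ξ t) ≤ 1) →
      p ^ 2 * (1 + r t ^ 2) ≤ r' t := by
    intro t ht hcase
    obtain ⟨hC, hS⟩ := bounds_of_energy hm₁ hm₂ (h.theta_mem h0 (ha.trans ht.1)) (hE t ht)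
    change p ≤ _ at hS
    have hS0 : 0 < sin (2 * θ t) := hp0.trans_le hS
    set v := -cos (α t) with hv
    set w := sin (2 * θ t) * r t with hw
    have hv0 : p ≤ v := by linarith
    have hvw : v ^ 2 + w ^ 2 ≤ r' t := by
      have e : r' t = 2 * v ^ 2 - v * (w * damping g m₁ m₂ (ξ t)) + (m₁ + m₂) * w ^ 2 := by
        rw [hr', hv, hw]; ring
      have hwd : w * damping g m₁ m₂ (ξ t) ≤ |w| := by
        rcases hcase with ⟨h1, h2⟩ | ⟨h1, h2⟩
        · exact (mul_nonpos_of_nonpos_of_nonneg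
            (mul_nonpos_of_nonneg_of_nonpos hS0.le h1) h2).trans (abs_nonneg _)
        · have hw0 : 0 ≤ w := mul_nonneg hS0.le h1
          rw [abs_of_nonneg hw0]
          exact mul_le_of_le_one_right hw0 h2
      have h3 := mul_le_mul_of_nonneg_left hwd (hp0.le.trans hv0)
      have h4 := mul_le_mul_of_nonneg_right hn (sq_nonneg w)
      rw [e]
      nlinarith [sq_abs w, sq_nonneg (v - |w|), sq_nonneg v, sq_nonneg w]
    have h5 : p ^ 2 ≤ v ^ 2 := by gcongr
    have h6 : p ^ 2 * r t ^ 2 ≤ w ^ 2 := by rw [hw, mul_pow]; gcongr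
    linarith
  have hpersist : ∀ t₀ ∈ Icc a c, 0 ≤ r t₀ → ∀ t ∈ Icc t₀ c, 0 ≤ r t := by
    intro t₀ ht₀ hrt₀ t ht
    have hsub : ∀ x ∈ Icc t₀ c, x ∈ Icc a c := fun x hx => ⟨ht₀.1.trans hx.1, hx.2⟩
    have := image_le_of_deriv_right_lt_deriv_boundary (f := fun t => -r t)
      (f' := fun t => -r' t) (a := t₀) (b := c) (B := fun _ => 0) (B' := fun _ => 0)
      (fun x hx => (hr x (hsub x hx)).neg.continuousAt.continuousWithinAt)
      (fun x hx => (hr x (hsub x (Ico_subset_Icc_self hx))).neg.hasDerivWithinAt)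
      (by simpa using hrt₀) (fun x => hasDerivAt_const x 0)
      (fun x hx hx0 => by
        have hxm := hsub x (Ico_subset_Icc_self hx)
        obtain ⟨hC, -⟩ := bounds_of_energy hm₁ hm₂ (h.theta_mem h0 (ha.trans hxm.1)) (hE x hxm)
        have hrx : r x = 0 := neg_eq_zero.1 hx0
        have : r' x = 2 * cos (α x) ^ 2 := by
          simp only [hr', hrx]; ring
        rw [this]
        nlinarith) ht
    simpa using this
  have hrb : 0 ≤ r b := by
    by_contra! hneg
    have hnegall : ∀ t ∈ Icc a b, r t ≤ 0 := fun t ht => by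
      by_contra! hpos
      exact hneg.not_ge (hpersist t ⟨ht.1, ht.2.trans hbc⟩ hpos.le b ⟨ht.2, hbc⟩)
    refine hlen₁.not_gt (riccati_not_on_long_interval hab
      (fun x hx => hr x ⟨hx.1, hx.2.trans hbc⟩) fun x hx => ?_)
    exact hgrowth x ⟨hx.1, hx.2.trans hbc⟩ (.inl ⟨hnegall x hx, hK₁ x hx⟩)
  refine hlen₂.not_gt (riccati_not_on_long_interval hbc
    (fun x hx => hr x ⟨hab.trans hx.1, hx.2⟩) fun x hx => ?_)
  exact hgrowth x ⟨hab.trans hx.1, hx.2⟩ (.inr ⟨hpersist b ⟨hab, hbc⟩ hrb x hx, hK₂ x hx⟩)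

end IsSolution

/-- Proposition 3.2 (i): there is a threshold `R` so that every `ξ₀ > R` is
of type 1; in particular `ξ₀* < ∞`. -/
theorem stmt9 (g m₁ m₂ : ℕ) (hg : g = 1 ∨ g = 2 ∨ g = 3 ∨ g = 4 ∨ g = 6)
    (hm₁ : 0 < m₁) (hm₂ : 0 < m₂)
    (Ξ Θ A : ℝ → ℝ → ℝ) (hfam : IsShootingFamily g m₁ m₂ Ξ Θ A) :
    ∃ R : ℝ, ∀ ξ₀ > R, Type1 m₁ m₂ Ξ Θ A ξ₀ := by
  have hg0 : 0 < g := by omega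
  have hmem := thetaStar_mem hm₁ hm₂
  have hM0 : 0 < mconst g m₁ m₂ := by rw [mconst]; positivity
  set p := orbitWeight m₁ m₂ (thetaStar m₁ m₂) with hp
  have hp0 : 0 < p := orbitWeight_pos hmem
  set L := π / p ^ 2 with hL
  have hL0 : 0 < L := by positivity
  have hpL : p ^ 2 * L = π := by rw [hL]; field_simp
  set ε := p / 2 * exp (-(2 * mconst g m₁ m₂ * L)) with hε
  have hε0 : 0 < ε := by positivity
  have hεp : ε ≤ p / 2 :=
    mul_le_of_le_one_right (by positivity) (exp_le_one_iff.2 (neg_nonpos.2 (by positivity)))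
  have hεexp : ε * exp (2 * mconst g m₁ m₂ * L) = p / 2 := by
    rw [hε, mul_assoc, ← exp_add, neg_add_cancel, exp_zero, mul_one]
  have hκ : 0 < 4 / (g : ℝ) := by positivity
  set c := log (mconst g m₁ m₂ + 1) / (4 / (g : ℝ)) with hc
  have hdc : damping g m₁ m₂ c = 1 := by
    rw [damping, hc, mul_div_cancel₀ _ hκ.ne', exp_log (by positivity)]
    ring
  have hdmono : Monotone (damping g m₁ m₂) := fun x y hxy => by
    unfold damping
    gcongr
  obtain ⟨R, hR⟩ := IsSolution.exists_energy_ge hg0 hm₁ hm₂ hε0 (by linarith)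
  refine ⟨max R (c + 1 + L), fun ξ₀ hξ₀ => ?_⟩
  obtain ⟨h, hξ, hθ, hα⟩ := hfam ξ₀
  generalize hΞ : Ξ ξ₀ = ξ at h hξ
  generalize hΘ : Θ ξ₀ = θ at h hθ
  generalize hA : A ξ₀ = α at h hα
  have h0 : θ 0 ∈ Ioo 0 (π / 2) := by rw [hθ]; exact hmem
  have hξR : R < ξ 0 := by rw [hξ]; exact (le_max_left _ _).trans_lt hξ₀
  have hξc : c + 1 + L < ξ 0 := by rw [hξ]; exact (le_max_right _ _).trans_lt hξ₀
  obtain ⟨s, hs, hEs⟩ := hR ξ θ α h hξR hθ hα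
  have hE₁ : ∀ t, s ≤ t → (∀ u ∈ Icc 0 t, c ≤ ξ u) → p - ε ≤ energy m₁ m₂ θ α t :=
    fun t hst hu => hEs.trans (h.energy_mono hm₁ hm₂ h0 hs.1.le hst fun u hu' =>
      zero_le_one.trans (hdc.symm.le.trans (hdmono (hu u ⟨hs.1.le.trans hu'.1, hu'.2⟩))))
  obtain ⟨b, hb0, hbc, hbu⟩ := h.exists_first_time hm₁ hm₂ h0 hs.1.le
    (fun t hst hu => by linarith [hE₁ t hst hu]) (by linarith : c < ξ 0)
  have hsb : s + L ≤ b := by linarith [h.sub_le_xi hb0, hs.2]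
  have hE : ∀ t ∈ Icc s (b + L), p / 2 ≤ energy m₁ m₂ θ α t := fun t ht => by
    rcases le_total t b with htb | hbt
    · linarith [hE₁ t ht.1 fun u hu => hbu u ⟨hu.1, hu.2.trans htb⟩]
    · have h1 := h.energy_gap_le hm₁ hm₂ h0 hb0 hbt
      have h2 : (p - energy m₁ m₂ θ α b) * exp (2 * mconst g m₁ m₂ * (t - b)) ≤
          ε * exp (2 * mconst g m₁ m₂ * L) := by
        have := hE₁ b (by linarith) hbu
        gcongr
        · linarith
        · linarith [ht.2]
      rw [hεexp] at h2
      linarith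
  have hEpos : ∀ t ∈ Ioc 0 (b + L), 0 < energy m₁ m₂ θ α t := fun t ht => by
    rcases le_total s t with hst | hts
    · exact (half_pos hp0).trans_le (hE t ⟨hst, ht.2⟩)
    · refine h.energy_pos hm₁ hm₂ h0 hα ht.1 fun u hu => zero_lt_one.trans_le ?_
      exact hdc.symm.le.trans (hdmono (hbu u ⟨hu.1, by linarith [hu.2]⟩))
  by_cases hT : ∃ T ∈ Ioc 0 (b + L), θ T = thetaStar m₁ m₂
  · obtain ⟨T, hT, hTθ⟩ := hT
    refine ⟨T, hT.1, by rw [hΘ, hTθ], fun t ht => ?_⟩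
    rw [hΘ, hA]
    refine mul_ne_zero (fun hz => ?_) (sin_two_mul_pos (h.theta_mem h0 ht.1.le)).ne'
    have := hEpos t ⟨ht.1, ht.2.le.trans hT.2⟩
    rw [energy, hz, mul_zero, neg_zero] at this
    exact this.false
  · push Not at hT
    exfalso
    obtain ⟨x, hx, hxθ⟩ := exists_gt_of_hasDerivAt_pos hs.1 (h 0).2.1 (by
      rw [hα, sin_pi_div_two, one_mul]; exact sin_two_mul_pos h0)
    rw [hθ] at hxθ
    refine h.not_thetaStar_lt hm₁ hm₂ h0 hs.1.le (by linarith : s ≤ b)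
      (by linarith : b ≤ b + L) ?_ ?_ hE
      (fun t ht => zero_le_one.trans
        (hdc.symm.le.trans (hdmono (hbu t ⟨hs.1.le.trans ht.1, ht.2⟩)))) ?_ ?_
    · rw [← hpL]; gcongr; linarith
    · rw [← hpL]; gcongr; linarith
    · intro t ht
      refine (hdmono ?_).trans hdc.le
      have := le_of_hasDerivAt_nonneg ht.1 (fun u _ => (h u).1.neg) fun u hu => by
        obtain ⟨h1, h2⟩ := IsSolution.bounds_of_energy hm₁ hm₂ (h.theta_mem h0 (hb0.trans hu.1))
          (hE u ⟨by linarith [hu.1], hu.2.trans ht.2⟩)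
        change p ≤ _ at h2
        nlinarith
      simp only [Pi.neg_apply] at this
      linarith
    · intro t ht
      refine lt_of_forall_ne_of_continuous h.continuous_theta (hx.2.le.trans ht.1) hxθ
        fun u hu => hT u ⟨hx.1.trans_le hu.1, hu.2.trans ht.2⟩
end
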